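/- Two-ball counting estimate (Lemma 3.2): Let 1 < α ≤ 2. There exists a constant C = C(α) > 0 such that for all dyadic numbers N, A, B ≥ 1, every a ∈ ℤ³ with |a| ∼ A, every sign ς ∈ {−1, +1}, and every ζ ∈ ℝ, the cardinality of the set { n ∈ ℤ³ : |n| ∼ N, |n+a| ∼ B, and |⟪a+n⟫ + ς·⟪n⟫ − ζ| ≤ 1 } is at most C · min(A, B, N)^{−1} · min(B, N)³. -/

import Mathlib

noncomputable section

open scoped BigOperators

/-- Japanese bracket of a real number: `⟨x⟩ = (1 + x²)^{1/2}`. -/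
def rjb (x : ℝ) : ℝ := Real.sqrt (1 + x ^ 2)

/-- Euclidean norm of a lattice point in `ℤ³`. -/
def znorm (n : Fin 3 → ℤ) : ℝ := Real.sqrt (∑ i, ((n i : ℝ)) ^ 2)

/-- Japanese bracket `⟨n⟩ = (1 + |n|²)^{1/2}` of a lattice point in `ℤ³`. -/
def jb (n : Fin 3 → ℤ) : ℝ := Real.sqrt (1 + ∑ i, ((n i : ℝ)) ^ 2)

/-- The modified bracket `⟪n⟫ = (⟨n⟩^{2α} − 1/4)^{1/2}`. -/
def jbb (α : ℝ) (n : Fin 3 → ℤ) : ℝ := Real.sqrt (jb n ^ (2 * α) - 1 / 4)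

/-- Dyadic numbers `2^j`, `j ≥ 0`. -/
def IsDyadic (N : ℝ) : Prop := ∃ j : ℕ, N = 2 ^ j

/-- `|n| ∼ N` for a dyadic number `N`: `N/2 < |n| ≤ N` if `N ≥ 2`, and `|n| ≤ 1` if `N = 1`. -/
def SimFreq (N : ℝ) (n : Fin 3 → ℤ) : Prop :=
  (2 ≤ N ∧ N / 2 < znorm n ∧ znorm n ≤ N) ∨ (N < 2 ∧ znorm n ≤ 1)

/-- `x` is a sign `±1`. -/
def IsSign (x : ℝ) : Prop := x = 1 ∨ x = -1

open Classical in
/-- Real-valued indicator of a proposition. -/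
def ind (p : Prop) : ℝ := if p then 1 else 0

/-- The radial profile `u ↦ α u^(α-1) / (u^α - 1/4)^(1/2)` of the gradient of
`x ↦ ((1 + ‖x‖²)^α - 1/4)^(1/2)`. -/
def gradProfile (α u : ℝ) : ℝ := α * u ^ (α - 1) / Real.sqrt (u ^ α - 1 / 4)

/-- The function `x ↦ ((1 + ‖x‖²)^α - 1/4)^(1/2)` on a normed space. -/
def dispersion {V : Type*} [NormedAddCommGroup V] (α : ℝ) (x : V) : ℝ :=
  Real.sqrt ((1 + ‖x‖ ^ 2) ^ α - 1 / 4)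

lemma le_rpow_of_one_le {α u : ℝ} (hα : 1 ≤ α) (hu : 1 ≤ u) : u ≤ u ^ α := by
  simpa using Real.rpow_le_rpow_of_exponent_le hu hα

lemma hasDerivAt_sqrt_rpow_sub {α u : ℝ} (hα : 1 ≤ α) (hu : 1 ≤ u) :
    HasDerivAt (fun u : ℝ => Real.sqrt (u ^ α - 1 / 4)) (gradProfile α u / 2) u := by
  have hX := le_rpow_of_one_le hα hu
  have h := ((Real.hasDerivAt_rpow_const (x := u) (p := α) (Or.inl (by linarith))).sub_const
    (1 / 4 : ℝ)).sqrt (by linarith)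
  convert h using 1
  unfold gradProfile
  field_simp

lemma exists_hasDerivAt_gradProfile {α u : ℝ} (hα₁ : 1 < α) (hα₂ : α ≤ 2) (hu : 1 ≤ u) :
    ∃ k' : ℝ, HasDerivAt (gradProfile α) k' u ∧
      -(1 - (α - 1) / 2) * gradProfile α u ≤ 2 * (u - 1) * k' ∧ k' ≤ 0 := by
  have hu0 : 0 < u := by linarith
  have hX := le_rpow_of_one_le hα₁.le hu
  have hD : 0 < u ^ α - 1 / 4 := by linarith
  have hs := Real.sqrt_pos.2 hD
  have hk : 0 < gradProfile α u := by unfold gradProfile; positivity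
  have hderiv : HasDerivAt (gradProfile α)
      (gradProfile α u * ((α - 1) / u - α * u ^ α / (2 * u * (u ^ α - 1 / 4)))) u := by
    have h := ((Real.hasDerivAt_rpow_const (x := u) (p := α - 1) (Or.inl hu0.ne')).const_mul
      α).div (hasDerivAt_sqrt_rpow_sub hα₁.le hu) hs.ne'
    refine h.congr_deriv ?_
    have e1 : u ^ (α - 1 - 1) = u ^ α / u / u := by
      rw [Real.rpow_sub_one hu0.ne', Real.rpow_sub_one hu0.ne']
    have e2 : u ^ (α - 1) = u ^ α / u := Real.rpow_sub_one hu0.ne' α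
    unfold gradProfile
    rw [e1, e2]
    have hsq := Real.sq_sqrt hD.le
    set s := Real.sqrt (u ^ α - 1 / 4)
    rw [← hsq]
    field_simp
  have hbr : (α - 1) / u - α * u ^ α / (2 * u * (u ^ α - 1 / 4)) =
      -(((2 - α) * u ^ α + (α - 1) / 2) / (2 * u * (u ^ α - 1 / 4))) := by
    obtain ⟨D, hD'⟩ : ∃ D, u ^ α - 1 / 4 = D := ⟨_, rfl⟩
    have hX' : u ^ α = D + 1 / 4 := by linarith
    rw [hD'] at hD
    rw [hD', hX']
    field_simp
    ring
  rw [hbr] at hderiv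
  refine ⟨_, hderiv, ?_, ?_⟩
  · generalize u ^ α = X at *
    have key : 2 * (u - 1) * (((2 - α) * X + (α - 1) / 2) / (2 * u * (X - 1 / 4)))
        ≤ 1 - (α - 1) / 2 := by
      rw [← mul_div_assoc, div_le_iff₀ (by positivity)]
      nlinarith [mul_nonneg (sub_nonneg.2 hα₁.le) (mul_nonneg hu0.le (sub_nonneg.2 hX)),
        mul_nonneg (sub_nonneg.2 hα₂) (sub_nonneg.2 hX),
        mul_nonneg (sub_nonneg.2 hα₁.le) (sq_nonneg (u - 1)),
        mul_nonneg (sub_nonneg.2 hα₁.le) hu0.le, mul_nonneg (sub_nonneg.2 hα₂) hu0.le]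
    nlinarith
  · have h : 0 ≤ ((2 - α) * u ^ α + (α - 1) / 2) / (2 * u * (u ^ α - 1 / 4)) := by
      have := mul_nonneg (sub_nonneg.2 hα₂) (by linarith : 0 ≤ u ^ α)
      apply div_nonneg _ (by positivity)
      linarith
    nlinarith

lemma inv_sqrt_le_gradProfile {α u : ℝ} (hα : 1 ≤ α) (hu : 1 ≤ u) :
    (Real.sqrt u)⁻¹ ≤ gradProfile α u := by
  have hu0 : 0 < u := by linarith
  have hX := le_rpow_of_one_le hα hu
  have hs := Real.sqrt_pos.2 (by linarith : 0 < u ^ α - 1 / 4)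
  have hsu := Real.sqrt_pos.2 hu0
  unfold gradProfile
  rw [Real.rpow_sub_one hu0.ne', le_div_iff₀ hs, inv_mul_le_iff₀ hsu, Real.sqrt_le_iff]
  refine ⟨by positivity, ?_⟩
  have h1 : (Real.sqrt u * (α * (u ^ α / u))) ^ 2 = α ^ 2 * u ^ α * (u ^ α / u) := by
    rw [mul_pow, Real.sq_sqrt hu0.le]; field_simp
  rw [h1]
  have h2 : 1 ≤ u ^ α / u := (one_le_div hu0).2 hX
  have h3 : u ^ α ≤ α ^ 2 * u ^ α :=
    le_mul_of_one_le_left (by linarith) (one_le_pow₀ hα)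
  nlinarith

section Convexity

variable {V : Type*} [NormedAddCommGroup V] [InnerProductSpace ℝ V]

lemma hasDerivAt_norm_sq_line (x w : V) (s : ℝ) :
    HasDerivAt (fun s : ℝ => 1 + ‖x + s • w‖ ^ 2) (2 * inner ℝ (x + s • w) w) s := by
  have h : HasDerivAt (fun s : ℝ => x + s • w) w s := by
    simpa using ((hasDerivAt_id s).smul_const w).const_add x
  exact (h.norm_sq).const_add 1

lemma hasDerivAt_dispersion_line {α : ℝ} (hα : 1 ≤ α) (x w : V) (s : ℝ) :
    HasDerivAt (fun s : ℝ => dispersion α (x + s • w))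
      (gradProfile α (1 + ‖x + s • w‖ ^ 2) * inner ℝ (x + s • w) w) s := by
  have h := (hasDerivAt_sqrt_rpow_sub hα (u := 1 + ‖x + s • w‖ ^ 2)
    (by nlinarith [sq_nonneg ‖x + s • w‖])).comp s (hasDerivAt_norm_sq_line x w s)
  refine h.congr_deriv ?_
  ring

/-- Quantitative monotonicity of the gradient of `dispersion α`, tested against a direction `w`
nearly parallel to the increment `v`. -/
lemma gradient_increment_lower_bound {α R : ℝ} (hα₁ : 1 < α) (hα₂ : α ≤ 2) (hR : 1 ≤ R)
    {z v w : V} (hz : ‖z‖ ≤ R) (hzv : ‖z + v‖ ≤ R)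
    (hvw : (1 - (α - 1) / 4) * (‖v‖ * ‖w‖) ≤ inner ℝ v w) :
    (α - 1) / 8 * (‖v‖ * ‖w‖ / R) ≤
      gradProfile α (1 + ‖z + v‖ ^ 2) * inner ℝ (z + v) w
        - gradProfile α (1 + ‖z‖ ^ 2) * inner ℝ z w := by
  have hu : ∀ s : ℝ, 1 ≤ 1 + ‖z + s • v‖ ^ 2 := fun s => by nlinarith [sq_nonneg ‖z + s • v‖]
  choose k' hk' hlow hneg using fun s : ℝ => exists_hasDerivAt_gradProfile hα₁ hα₂ (hu s)
  have hd : ∀ s : ℝ, HasDerivAt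
      (fun s : ℝ => gradProfile α (1 + ‖z + s • v‖ ^ 2) * inner ℝ (z + s • v) w)
      (k' s * (2 * inner ℝ (z + s • v) v) * inner ℝ (z + s • v) w
        + gradProfile α (1 + ‖z + s • v‖ ^ 2) * inner ℝ v w) s := by
    intro s
    have h1 : HasDerivAt (fun s : ℝ => z + s • v) v s := by
      simpa using ((hasDerivAt_id s).smul_const v).const_add z
    have h2 : HasDerivAt (fun s : ℝ => inner ℝ (z + s • v) w) (inner ℝ v w) s := by
      simpa using h1.inner ℝ (hasDerivAt_const s w)
    exact ((hk' s).comp s (hasDerivAt_norm_sq_line z v s)).mul h2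
  obtain ⟨s, hs, hmean⟩ := exists_hasDerivAt_eq_slope _ _ (zero_lt_one (α := ℝ))
    (fun s _ => (hd s).continuousAt.continuousWithinAt) (fun s _ => hd s)
  simp only [one_smul, zero_smul, add_zero, sub_zero, div_one] at hmean
  rw [← hmean]
  have hball : ‖z + s • v‖ ≤ R := by
    have hc := (convex_closedBall (0 : V) R).add_smul_mem (x := z) (y := v) (by simpa using hz)
      (by simpa using hzv) (t := s) ⟨hs.1.le, hs.2.le⟩
    simpa using hc
  set x := z + s • v
  have hlow' := hlow s
  have hneg' := hneg s
  have hk : (2 * R)⁻¹ ≤ gradProfile α (1 + ‖x‖ ^ 2) := by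
    refine le_trans ?_ (inv_sqrt_le_gradProfile hα₁.le (hu s))
    refine inv_anti₀ (Real.sqrt_pos.2 (by positivity)) (Real.sqrt_le_iff.2 ⟨by positivity, ?_⟩)
    nlinarith [norm_nonneg x]
  have hR0 : 0 < (2 * R)⁻¹ := by positivity
  have hCS : inner ℝ x v * inner ℝ x w ≤ ‖x‖ ^ 2 * (‖v‖ * ‖w‖) := by
    calc inner ℝ x v * inner ℝ x w ≤ |inner ℝ x v| * |inner ℝ x w| := by
          rw [← abs_mul]; exact le_abs_self _
      _ ≤ (‖x‖ * ‖v‖) * (‖x‖ * ‖w‖) :=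
          mul_le_mul (abs_real_inner_le_norm _ _) (abs_real_inner_le_norm _ _) (abs_nonneg _)
            (by positivity)
      _ = _ := by ring
  have hP : 0 ≤ ‖v‖ * ‖w‖ := by positivity
  have e : (α - 1) / 8 * (‖v‖ * ‖w‖ / R) = (α - 1) / 4 * (‖v‖ * ‖w‖) * (2 * R)⁻¹ := by
    field_simp; ring
  rw [e]
  set g := gradProfile α (1 + ‖x‖ ^ 2)
  set P := ‖v‖ * ‖w‖
  have h1 : 2 * k' s * (‖x‖ ^ 2 * P) ≤ 2 * k' s * (inner ℝ x v * inner ℝ x w) :=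
    mul_le_mul_of_nonpos_left hCS (by linarith)
  have h2 : -(1 - (α - 1) / 2) * g * P ≤ 2 * (1 + ‖x‖ ^ 2 - 1) * k' s * P :=
    mul_le_mul_of_nonneg_right hlow' hP
  have h3 : g * ((1 - (α - 1) / 4) * P) ≤ g * inner ℝ v w :=
    mul_le_mul_of_nonneg_left hvw (by linarith)
  have h4 : (α - 1) / 4 * P * (2 * R)⁻¹ ≤ (α - 1) / 4 * P * g :=
    mul_le_mul_of_nonneg_left hk (mul_nonneg (by linarith) hP)
  nlinarith

lemma norm_le_norm_add_smul {v w : V} (hvw : 0 ≤ inner ℝ v w) {r : ℝ} (hr : 0 ≤ r) :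
    ‖v‖ ≤ ‖v + r • w‖ := by
  refine le_of_sq_le_sq ?_ (norm_nonneg _)
  rw [norm_add_sq_real, inner_smul_right]
  nlinarith [sq_nonneg ‖r • w‖, mul_nonneg hr hvw]

lemma cone_add_smul {δ : ℝ} (hδ₀ : 0 ≤ δ) (hδ₁ : δ ≤ 1) {v w : V}
    (hvw : (1 - δ) * (‖v‖ * ‖w‖) ≤ inner ℝ v w) {r : ℝ} (hr : 0 ≤ r) :
    (1 - δ) * (‖v + r • w‖ * ‖w‖) ≤ inner ℝ (v + r • w) w := by
  have h1 : ‖v + r • w‖ ≤ ‖v‖ + r * ‖w‖ := by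
    refine (norm_add_le _ _).trans ?_
    rw [norm_smul, Real.norm_of_nonneg hr]
  rw [inner_add_left, inner_smul_left, real_inner_self_eq_norm_sq]
  have h2 := mul_le_mul_of_nonneg_left
    (mul_le_mul_of_nonneg_right h1 (norm_nonneg w)) (sub_nonneg.2 hδ₁)
  have h3 : 0 ≤ δ * (r * ‖w‖ ^ 2) := by positivity
  simp only [conj_trivial]
  nlinarith

/-- Growth of `dispersion α y + ς * dispersion α x` when both points move in a direction `w`
nearly parallel to `y + ς • x`. -/
lemma dispersion_increment_lower_bound {α R ς t : ℝ} (hα₁ : 1 < α) (hα₂ : α ≤ 2) (hR : 1 ≤ R)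
    (hς : IsSign ς) (ht : 0 < t) {x y w : V} (hx : ‖x‖ ≤ R) (hy : ‖y‖ ≤ R)
    (hxt : ‖x + t • w‖ ≤ R) (hyt : ‖y + t • w‖ ≤ R)
    (hvw : (1 - (α - 1) / 4) * (‖y + ς • x‖ * ‖w‖) ≤ inner ℝ (y + ς • x) w) :
    (α - 1) / 8 * (‖y + ς • x‖ * ‖w‖ / R) * t ≤
      (dispersion α (y + t • w) + ς * dispersion α (x + t • w))
        - (dispersion α y + ς * dispersion α x) := by
  have hd : ∀ s : ℝ, HasDerivAt
      (fun s : ℝ => dispersion α (y + s • w) + ς * dispersion α (x + s • w)) _ s := fun s =>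
    (hasDerivAt_dispersion_line hα₁.le y w s).add
      ((hasDerivAt_dispersion_line hα₁.le x w s).const_mul ς)
  obtain ⟨s, hs, hmean⟩ := exists_hasDerivAt_eq_slope _ _ ht
    (fun s _ => (hd s).continuousAt.continuousWithinAt) (fun s _ => hd s)
  rw [eq_div_iff (by linarith)] at hmean
  simp only [zero_smul, add_zero, sub_zero] at hmean
  rw [← hmean]
  refine mul_le_mul_of_nonneg_right ?_ ht.le
  have hball : ∀ p : V, ‖p‖ ≤ R → ‖p + t • w‖ ≤ R → ‖p + s • w‖ ≤ R := by
    intro p hp hpt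
    have hc := (convex_closedBall (0 : V) R).add_smul_mem (x := p) (y := t • w)
      (by simpa using hp) (by simpa using hpt) (t := s / t)
      ⟨(div_pos hs.1 ht).le, (div_le_one ht).2 hs.2.le⟩
    rw [smul_smul, div_mul_cancel₀ _ ht.ne'] at hc
    simpa using hc
  have hr : 0 ≤ (1 + ς) * s := by
    rcases hς with rfl | rfl
    · linarith [hs.1]
    · simp
  have hς2 : ς * ς = 1 := by rcases hς with rfl | rfl <;> norm_num
  have hςn : ‖ς‖ = 1 := by rcases hς with rfl | rfl <;> simp
  have hv : (y + s • w) + ς • (x + s • w) = (y + ς • x) + ((1 + ς) * s) • w := by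
    module
  have hcone := cone_add_smul (by linarith) (by linarith) hvw hr
  rw [← hv] at hcone
  have hz : ‖-(ς • (x + s • w))‖ = ‖x + s • w‖ := by rw [norm_neg, norm_smul, hςn, one_mul]
  have hsum : -(ς • (x + s • w)) + ((y + s • w) + ς • (x + s • w)) = y + s • w := by abel
  have h := gradient_increment_lower_bound hα₁ hα₂ hR (z := -(ς • (x + s • w)))
    (v := (y + s • w) + ς • (x + s • w)) (w := w) (by rw [hz]; exact hball x hx hxt)
    (by rw [hsum]; exact hball y hy hyt) hcone
  rw [hsum, hz, inner_neg_left, inner_smul_left] at h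
  have hinner : 0 ≤ inner ℝ (y + ς • x) w :=
    le_trans (mul_nonneg (by linarith) (by positivity)) hvw
  have hgrow := norm_le_norm_add_smul hinner hr
  rw [← hv] at hgrow
  have hmono : (α - 1) / 8 * (‖y + ς • x‖ * ‖w‖ / R) ≤
      (α - 1) / 8 * (‖(y + s • w) + ς • (x + s • w)‖ * ‖w‖ / R) := by
    have : 0 ≤ (α - 1) / 8 := by linarith
    gcongr
  simp only [conj_trivial] at h
  linarith

end Convexity

lemma finite_setOf_box (c : Fin 3 → ℝ) (L : ℝ) :
    {n : Fin 3 → ℤ | ∀ i, |(n i : ℝ) - c i| ≤ L}.Finite := by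
  refine (Fintype.piFinset fun i => Finset.Icc ⌈c i - L⌉ ⌊c i + L⌋).finite_toSet.subset ?_
  intro n hn
  simp only [Finset.mem_coe, Fintype.mem_piFinset, Finset.mem_Icc, Int.ceil_le, Int.le_floor]
  intro i
  have := abs_le.1 (hn i)
  constructor <;> linarith

lemma card_le_of_box {T : Finset (Fin 3 → ℤ)} {c : Fin 3 → ℝ} {L : ℝ} (hL : 1 ≤ L)
    (hT : ∀ n ∈ T, ∀ i, |(n i : ℝ) - c i| ≤ L) : (T.card : ℝ) ≤ 27 * L ^ 3 := by
  have hsub : T ⊆ Fintype.piFinset fun i => Finset.Icc ⌈c i - L⌉ ⌊c i + L⌋ := by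
    intro n hn
    simp only [Fintype.mem_piFinset, Finset.mem_Icc, Int.ceil_le, Int.le_floor]
    intro i
    have := abs_le.1 (hT n hn i)
    constructor <;> linarith
  have hside : ∀ i, ((Finset.Icc ⌈c i - L⌉ ⌊c i + L⌋).card : ℝ) ≤ 3 * L := by
    intro i
    rw [Int.card_Icc]
    have h1 := Int.le_ceil (c i - L)
    have h2 := Int.floor_le (c i + L)
    have h3 : (((⌊c i + L⌋ + 1 - ⌈c i - L⌉).toNat : ℤ) : ℝ) ≤ 3 * L := by
      rw [Int.toNat_eq_max, Int.cast_max]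
      push_cast
      exact max_le (by linarith) (by linarith)
    exact_mod_cast h3
  calc (T.card : ℝ) ≤ ((Fintype.piFinset fun i => Finset.Icc ⌈c i - L⌉ ⌊c i + L⌋).card : ℝ) := by
        exact_mod_cast Finset.card_le_card hsub
    _ = ∏ i, ((Finset.Icc ⌈c i - L⌉ ⌊c i + L⌋).card : ℝ) := by
        rw [Fintype.card_piFinset]; push_cast; rfl
    _ ≤ ∏ _i : Fin 3, (3 * L) := Finset.prod_le_prod (fun _ _ => by positivity) fun i _ => hside i
    _ = 27 * L ^ 3 := by simp; ring

/-- If lattice points of `T` on a common line of direction `w` are fewer than `P` steps apart, then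
the translates of `T` by multiples of `P • w` are disjoint, which bounds the size of `T`. -/
lemma card_le_of_short_on_lines {T : Finset (Fin 3 → ℤ)} {c : Fin 3 → ℝ} {L M : ℝ} (hL : 1 ≤ L)
    (hM : 1 ≤ M) (hT : ∀ n ∈ T, ∀ i, |(n i : ℝ) - c i| ≤ L)
    {w : Fin 3 → ℤ} (hw : ∀ i, |(w i : ℝ)| ≤ M)
    {P : ℕ} (hP : 0 < P) (hline : ∀ n ∈ T, ∀ t : ℕ, n + t • w ∈ T → t < P) :
    (T.card : ℝ) ≤ 27 * (1 + 2 * M) ^ 3 * (L ^ 2 * P) := by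
  have hP1 : (1 : ℝ) ≤ P := by exact_mod_cast hP
  rcases lt_or_ge L (P : ℝ) with hLP | hPL
  · calc (T.card : ℝ) ≤ 27 * L ^ 3 := card_le_of_box hL hT
      _ ≤ 27 * (L ^ 2 * P) := by nlinarith [sq_nonneg L]
      _ ≤ 27 * (1 + 2 * M) ^ 3 * (L ^ 2 * P) := by
        refine mul_le_mul_of_nonneg_right ?_ (by positivity)
        have : (1 : ℝ) ≤ (1 + 2 * M) ^ 3 := one_le_pow₀ (by linarith)
        linarith
  · set J := ⌈L / P⌉₊
    have hJ1 : L ≤ J * P := (div_le_iff₀ (by linarith)).1 (Nat.le_ceil _)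
    have hJ2 : J * P ≤ 2 * L := by
      have h := (Nat.ceil_lt_add_one (by positivity : 0 ≤ L / P)).le
      have h' := mul_le_mul_of_nonneg_right h (by positivity : (0 : ℝ) ≤ P)
      rw [add_mul, div_mul_cancel₀ _ (by positivity)] at h'
      linarith
    let f : (Fin 3 → ℤ) × ℕ → (Fin 3 → ℤ) := fun p => p.1 + (p.2 * P) • w
    have hinj : Set.InjOn f (T ×ˢ Finset.range J : Finset _) := by
      have haux : ∀ n ∈ T, ∀ n' ∈ T, ∀ j j' : ℕ, j ≤ j' →
          n + (j * P) • w = n' + (j' * P) • w → j = j' := by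
        intro n hn n' hn' j j' hjj' h
        obtain ⟨d, rfl⟩ := Nat.exists_eq_add_of_le hjj'
        have hnn : n' + (d * P) • w = n := by
          have : n' + (d * P) • w + (j * P) • w = n + (j * P) • w := by
            rw [h, add_mul, add_smul]; abel
          exact add_right_cancel this
        have := hline n' hn' (d * P) (by rw [hnn]; exact hn)
        have hd : d < 1 := by
          by_contra hd
          exact absurd (Nat.le_mul_of_pos_left P (by omega : 0 < d)) (by omega)
        omega
      rintro ⟨n, j⟩ h ⟨n', j'⟩ h' heq
      simp only [Finset.coe_product, Set.mem_prod, Finset.mem_coe] at h h'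
      have hjj : j = j' := by
        rcases le_total j j' with hle | hle
        · exact haux n h.1 n' h'.1 j j' hle heq
        · exact (haux n' h'.1 n h.1 j' j hle heq.symm).symm
      subst hjj
      have : n = n' := add_right_cancel heq
      rw [this]
    have hcard : (T.card : ℝ) * J = (((T ×ˢ Finset.range J).image f).card : ℝ) := by
      rw [Finset.card_image_of_injOn hinj, Finset.card_product, Finset.card_range]
      push_cast
      rfl
    have hbox : ∀ m ∈ (T ×ˢ Finset.range J).image f, ∀ i, |(m i : ℝ) - c i| ≤ (1 + 2 * M) * L := by
      intro m hm i
      obtain ⟨⟨n, j⟩, hnj, rfl⟩ := Finset.mem_image.1 hm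
      obtain ⟨hn, hj⟩ := Finset.mem_product.1 hnj
      have hj' : (j : ℝ) ≤ J := by exact_mod_cast (Finset.mem_range.1 hj).le
      have e : ((f (n, j) i : ℤ) : ℝ) - c i = ((n i : ℝ) - c i) + (j * P : ℝ) * w i := by
        simp [f]; ring
      rw [e]
      refine (abs_add_le _ _).trans ?_
      rw [abs_mul, abs_of_nonneg (by positivity : (0 : ℝ) ≤ j * P)]
      have h1 : (j * P : ℝ) ≤ 2 * L := le_trans (by gcongr) hJ2
      have h2 : (j * P : ℝ) * |(w i : ℝ)| ≤ 2 * L * M :=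
        mul_le_mul h1 (hw i) (abs_nonneg _) (by positivity)
      have h3 := hT n hn i
      linarith
    have hle := card_le_of_box (by nlinarith) hbox
    rw [← hcard] at hle
    have h1 : (T.card : ℝ) * L ≤ 27 * ((1 + 2 * M) * L) ^ 3 * P :=
      calc (T.card : ℝ) * L ≤ T.card * (J * P) := by gcongr
        _ = T.card * J * P := by ring
        _ ≤ _ := by gcongr
    refine le_of_mul_le_mul_right (h1.trans_eq ?_) (by linarith : 0 < L)
    ring

/-- The embedding `ℤ³ → ℝ³`. -/
def latticeVec (n : Fin 3 → ℤ) : EuclideanSpace ℝ (Fin 3) := WithLp.toLp 2 fun i => (n i : ℝ)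

@[simp] lemma latticeVec_apply (n : Fin 3 → ℤ) (i : Fin 3) : latticeVec n i = n i := rfl

lemma latticeVec_add (n m : Fin 3 → ℤ) : latticeVec (n + m) = latticeVec n + latticeVec m := by
  ext i; simp

lemma latticeVec_nsmul (t : ℕ) (n : Fin 3 → ℤ) : latticeVec (t • n) = (t : ℝ) • latticeVec n := by
  ext i; simp

lemma norm_latticeVec (n : Fin 3 → ℤ) : ‖latticeVec n‖ = znorm n := by
  simp [EuclideanSpace.norm_eq, znorm]

lemma one_le_norm_latticeVec {n : Fin 3 → ℤ} (hn : n ≠ 0) : 1 ≤ ‖latticeVec n‖ := by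
  obtain ⟨i, hi⟩ := Function.ne_iff.1 hn
  have h1 : (1 : ℝ) ≤ |(n i : ℝ)| := by exact_mod_cast Int.one_le_abs hi
  exact h1.trans (by simpa using PiLp.norm_apply_le (latticeVec n) i)

lemma jbb_eq_dispersion (α : ℝ) (n : Fin 3 → ℤ) : jbb α n = dispersion α (latticeVec n) := by
  have h : (1 + ∑ i, ((n i : ℝ)) ^ 2) = 1 + ‖latticeVec n‖ ^ 2 := by
    simp [EuclideanSpace.norm_sq_eq]
  unfold jbb jb dispersion
  rw [h, Real.sqrt_eq_rpow (1 + ‖latticeVec n‖ ^ 2), ← Real.rpow_mul (by positivity)]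
  congr 3
  ring

/-- Every nonzero vector is nearly parallel to some lattice vector of bounded size. -/
lemma exists_lattice_direction {δ : ℝ} {M : ℕ} (hM : 2 ≤ δ * M) (hM1 : 2 ≤ M)
    {v : EuclideanSpace ℝ (Fin 3)} (hv : v ≠ 0) :
    ∃ w : Fin 3 → ℤ, w ≠ 0 ∧ (∀ i, |w i| ≤ (M + 1 : ℤ)) ∧
      (1 - δ) * (‖v‖ * ‖latticeVec w‖) ≤ inner ℝ v (latticeVec w) := by
  have hM1' : (2 : ℝ) ≤ M := by exact_mod_cast hM1
  have hv0 : 0 < ‖v‖ := norm_pos_iff.2 hv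
  set u : EuclideanSpace ℝ (Fin 3) := ((M : ℝ) / ‖v‖) • v
  have hu : ‖u‖ = M := by
    rw [norm_smul, Real.norm_of_nonneg (by positivity), div_mul_cancel₀ _ hv0.ne']
  set w : Fin 3 → ℤ := fun i => round (u i)
  have hdiff : ‖latticeVec w - u‖ ≤ 1 := by
    rw [EuclideanSpace.norm_eq, Real.sqrt_le_iff, one_pow, Fin.sum_univ_three]
    refine ⟨zero_le_one, ?_⟩
    have hi : ∀ i, ‖(latticeVec w - u) i‖ ^ 2 ≤ 1 / 4 := by
      intro i
      have h := abs_sub_round (u i)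
      rw [abs_sub_comm] at h
      have h' : ‖(latticeVec w - u) i‖ ≤ 1 / 2 := by simpa [w] using h
      nlinarith [norm_nonneg ((latticeVec w - u) i)]
    linarith [hi 0, hi 1, hi 2]
  have hwn : ‖latticeVec w‖ ≤ M + 1 := by
    have := norm_add_le (latticeVec w - u) u
    rw [sub_add_cancel] at this
    linarith
  have hinner : ‖v‖ * (M - 1) ≤ inner ℝ v (latticeVec w) := by
    have e : inner ℝ v (latticeVec w) = inner ℝ v u + inner ℝ v (latticeVec w - u) := by
      rw [← inner_add_right, add_sub_cancel]
    have e1 : inner ℝ v u = ‖v‖ * M := by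
      rw [inner_smul_right, real_inner_self_eq_norm_sq]
      field_simp
    have h := (abs_le.1 (abs_real_inner_le_norm v (latticeVec w - u))).1
    rw [e, e1]
    nlinarith
  refine ⟨w, ?_, ?_, ?_⟩
  · intro hw
    have : latticeVec w = 0 := by rw [hw]; ext i; simp
    rw [this, inner_zero_right] at hinner
    nlinarith
  · intro i
    have h : |(w i : ℝ)| ≤ M + 1 := by
      refine le_trans ?_ hwn
      simpa using PiLp.norm_apply_le (latticeVec w) i
    exact_mod_cast h
  · refine le_trans ?_ hinner
    rcases le_total δ 1 with hδ | hδ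
    · have h1 : (1 - δ) * ‖latticeVec w‖ ≤ (1 - δ) * (M + 1) :=
        mul_le_mul_of_nonneg_left hwn (by linarith)
      have hδ0 : 0 ≤ δ := by
        by_contra hneg
        nlinarith
      nlinarith
    · have : (1 - δ) * (‖v‖ * ‖latticeVec w‖) ≤ 0 :=
        mul_nonpos_of_nonpos_of_nonneg (by linarith) (by positivity)
      nlinarith

/-- The vector `(n + a) + ς n`. -/
def signedSum (ς : ℝ) (a n : Fin 3 → ℤ) : EuclideanSpace ℝ (Fin 3) :=
  latticeVec (n + a) + ς • latticeVec n

/-- The phase `⟪a + n⟫ + ς ⟪n⟫`. -/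
def phase (α ς : ℝ) (a n : Fin 3 → ℤ) : ℝ := jbb α (a + n) + ς * jbb α n

lemma card_le_of_cone {α : ℝ} (hα₁ : 1 < α) (hα₂ : α ≤ 2) {M : ℝ} (hM : 1 ≤ M)
    {w : Fin 3 → ℤ} (hw0 : w ≠ 0) (hw : ∀ i, |(w i : ℝ)| ≤ M)
    {a : Fin 3 → ℤ} {ς ζ L R K : ℝ} (hς : IsSign ς) {c : Fin 3 → ℝ} {T : Finset (Fin 3 → ℤ)}
    (hL : 1 ≤ L) (hR : 1 ≤ R) (hK : 0 < K)
    (hbox : ∀ n ∈ T, ∀ i, |(n i : ℝ) - c i| ≤ L) (hn : ∀ n ∈ T, ‖latticeVec n‖ ≤ R)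
    (hna : ∀ n ∈ T, ‖latticeVec (n + a)‖ ≤ R) (hv : ∀ n ∈ T, K ≤ ‖signedSum ς a n‖)
    (hφ : ∀ n ∈ T, |phase α ς a n - ζ| ≤ 1)
    (hcone : ∀ n ∈ T, (1 - (α - 1) / 4) * (‖signedSum ς a n‖ * ‖latticeVec w‖) ≤
      inner ℝ (signedSum ς a n) (latticeVec w)) :
    (T.card : ℝ) ≤ 27 * (1 + 2 * M) ^ 3 * (16 / (α - 1) + 1) * (L ^ 2 * (1 + R / K)) := by
  have hα0 : 0 < α - 1 := by linarith
  set Q : ℝ := 16 / (α - 1) * (R / K)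
  have hQ : 0 ≤ Q := by positivity
  have hline : ∀ n ∈ T, ∀ t : ℕ, n + t • w ∈ T → t < ⌊Q⌋₊ + 1 := by
    intro n hnT t htT
    rcases Nat.eq_zero_or_pos t with rfl | ht
    · omega
    rw [Nat.lt_succ_iff, Nat.le_floor_iff hQ]
    have ht' : (0 : ℝ) < t := by exact_mod_cast ht
    have e1 : latticeVec (n + t • w) = latticeVec n + (t : ℝ) • latticeVec w := by
      rw [latticeVec_add, latticeVec_nsmul]
    have e2 : latticeVec (n + t • w + a) = latticeVec (n + a) + (t : ℝ) • latticeVec w := by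
      rw [add_right_comm, latticeVec_add, latticeVec_nsmul]
    have hinc := dispersion_increment_lower_bound hα₁ hα₂ hR hς ht' (hn n hnT) (hna n hnT)
      (by rw [← e1]; exact hn _ htT) (by rw [← e2]; exact hna _ htT) (hcone n hnT)
    rw [← e1, ← e2] at hinc
    simp only [← jbb_eq_dispersion] at hinc
    have h1 := abs_le.1 (hφ n hnT)
    have h2 := abs_le.1 (hφ _ htT)
    simp only [phase, add_comm a] at h1 h2
    have hlow : K ≤ ‖latticeVec (n + a) + ς • latticeVec n‖ * ‖latticeVec w‖ :=
      (hv n hnT).trans (le_mul_of_one_le_right (norm_nonneg _) (one_le_norm_latticeVec hw0))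
    have h3 : (α - 1) / 8 * (K / R) * t ≤ 2 := by
      refine le_trans ?_ (hinc.trans (by linarith))
      gcongr
    have e3 : (t : ℝ) = (α - 1) / 8 * (K / R) * t * (8 / (α - 1) * (R / K)) := by
      field_simp
    rw [e3]
    calc _ ≤ 2 * (8 / (α - 1) * (R / K)) := by gcongr
      _ = Q := by simp only [Q]; ring
  have hcard := card_le_of_short_on_lines hL hM hbox hw (Nat.succ_pos _) hline
  have hP : ((⌊Q⌋₊ + 1 : ℕ) : ℝ) ≤ (16 / (α - 1) + 1) * (1 + R / K) := by
    push_cast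
    have h1 := Nat.floor_le hQ
    have h2 : 0 ≤ 16 / (α - 1) := by positivity
    have h3 : 0 ≤ R / K := by positivity
    simp only [Q] at h1 ⊢
    nlinarith
  refine hcard.trans ?_
  calc _ ≤ 27 * (1 + 2 * M) ^ 3 * (L ^ 2 * ((16 / (α - 1) + 1) * (1 + R / K))) := by gcongr
    _ = _ := by ring

/-- Counting lattice points of a box where the phase is nearly constant and `(n + a) + ς n` is
bounded below. -/
lemma exists_card_le_of_signedSum_ge {α : ℝ} (hα₁ : 1 < α) (hα₂ : α ≤ 2) :
    ∃ C : ℝ, 0 < C ∧ ∀ (a : Fin 3 → ℤ) (ς ζ L R K : ℝ) (c : Fin 3 → ℝ) (T : Finset (Fin 3 → ℤ)),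
      IsSign ς → 1 ≤ L → 1 ≤ R → 0 < K →
      (∀ n ∈ T, ∀ i, |(n i : ℝ) - c i| ≤ L) → (∀ n ∈ T, ‖latticeVec n‖ ≤ R) →
      (∀ n ∈ T, ‖latticeVec (n + a)‖ ≤ R) → (∀ n ∈ T, K ≤ ‖signedSum ς a n‖) →
      (∀ n ∈ T, |phase α ς a n - ζ| ≤ 1) →
      (T.card : ℝ) ≤ C * (L ^ 2 * (1 + R / K)) := by
  classical
  have hα0 : 0 < α - 1 := by linarith
  obtain ⟨M, hM⟩ := exists_nat_ge (8 / (α - 1) + 2)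
  have h8 : 0 < 8 / (α - 1) := by positivity
  have hM2 : 2 ≤ M := by
    have : (2 : ℝ) ≤ M := by linarith
    exact_mod_cast this
  have hδM : 2 ≤ (α - 1) / 4 * M := by
    have h : 8 / (α - 1) ≤ M := by linarith
    rw [div_le_iff₀ hα0] at h
    linarith
  set W : Finset (Fin 3 → ℤ) :=
    (Fintype.piFinset fun _ => Finset.Icc (-(M + 1 : ℤ)) (M + 1)).filter (· ≠ 0)
  set C₀ : ℝ := 27 * (1 + 2 * (M + 1 : ℝ)) ^ 3 * (16 / (α - 1) + 1)
  have hC₀ : 0 < C₀ := by positivity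
  refine ⟨(W.card + 1) * C₀, by positivity, ?_⟩
  intro a ς ζ L R K c T hς hL hR hK hbox hn hna hv hφ
  set Tw : (Fin 3 → ℤ) → Finset (Fin 3 → ℤ) := fun w =>
    T.filter fun n => (1 - (α - 1) / 4) * (‖signedSum ς a n‖ * ‖latticeVec w‖) ≤
      inner ℝ (signedSum ς a n) (latticeVec w)
  have hcover : T ⊆ W.biUnion Tw := by
    intro n hnT
    have hv0 : signedSum ς a n ≠ 0 := norm_pos_iff.1 (hK.trans_le (hv n hnT))
    obtain ⟨w, hw0, hwM, hcone⟩ := exists_lattice_direction hδM hM2 hv0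
    refine Finset.mem_biUnion.2 ⟨w, ?_, Finset.mem_filter.2 ⟨hnT, hcone⟩⟩
    refine Finset.mem_filter.2 ⟨Fintype.mem_piFinset.2 fun i => ?_, hw0⟩
    exact Finset.mem_Icc.2 (abs_le.1 (hwM i))
  have hpiece : ∀ w ∈ W, ((Tw w).card : ℝ) ≤ C₀ * (L ^ 2 * (1 + R / K)) := by
    intro w hw
    obtain ⟨hwM, hw0⟩ := Finset.mem_filter.1 hw
    have hT : ∀ n ∈ Tw w, n ∈ T := fun n h => (Finset.mem_filter.1 h).1
    refine card_le_of_cone hα₁ hα₂ (by linarith) hw0 (fun i => ?_) hς hL hR hK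
      (fun n h => hbox n (hT n h)) (fun n h => hn n (hT n h)) (fun n h => hna n (hT n h))
      (fun n h => hv n (hT n h)) (fun n h => hφ n (hT n h))
      (fun n h => (Finset.mem_filter.1 h).2)
    exact_mod_cast abs_le.2 (Finset.mem_Icc.1 (Fintype.mem_piFinset.1 hwM i))
  have hX : 0 ≤ C₀ * (L ^ 2 * (1 + R / K)) := by positivity
  calc (T.card : ℝ) ≤ ∑ w ∈ W, ((Tw w).card : ℝ) := by
        exact_mod_cast (Finset.card_le_card hcover).trans Finset.card_biUnion_le
    _ ≤ ∑ _w ∈ W, C₀ * (L ^ 2 * (1 + R / K)) := Finset.sum_le_sum hpiece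
    _ = W.card * (C₀ * (L ^ 2 * (1 + R / K))) := by rw [Finset.sum_const, nsmul_eq_mul]
    _ ≤ (W.card + 1) * C₀ * (L ^ 2 * (1 + R / K)) := by linarith

lemma abs_add_half_le_of_signedSum_one (a n : Fin 3 → ℤ) (i : Fin 3) :
    |(n i : ℝ) - -(a i : ℝ) / 2| ≤ ‖signedSum 1 a n‖ / 2 := by
  have h := PiLp.norm_apply_le (signedSum 1 a n) i
  have e : signedSum 1 a n i = 2 * ((n i : ℝ) - -(a i : ℝ) / 2) := by
    simp [signedSum]
    ring
  rw [e, Real.norm_eq_abs, abs_mul, abs_two] at h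
  linarith

/-- Dyadic summation over the size of `2 n + a`. -/
lemma card_le_of_signedSum_one_lt {C : ℝ} (hC : 0 < C) {a : Fin 3 → ℤ} {R : ℝ} (hR : 0 ≤ R)
    {T : Finset (Fin 3 → ℤ)}
    (hshell : ∀ (K : ℝ) (U : Finset (Fin 3 → ℤ)), 1 ≤ K → U ⊆ T →
      (∀ n ∈ U, ∀ i, |(n i : ℝ) - -(a i : ℝ) / 2| ≤ K) → (∀ n ∈ U, K ≤ ‖signedSum 1 a n‖) →
      (U.card : ℝ) ≤ C * (K ^ 2 * (1 + R / K))) (J : ℕ) :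
    ∀ U ⊆ T, (∀ n ∈ U, ‖signedSum 1 a n‖ < 2 ^ J) →
      (U.card : ℝ) ≤ 27 + C * ((2 ^ J) ^ 2 + R * 2 ^ J) := by
  induction J with
  | zero =>
    intro U _ hlt
    have h := card_le_of_box (T := U) (c := fun i => -(a i : ℝ) / 2) le_rfl fun n hn i => by
      have h1 := abs_add_half_le_of_signedSum_one a n i
      have h2 := hlt n hn
      norm_num at h2
      linarith
    have : 0 ≤ C * ((2 ^ 0) ^ 2 + R * 2 ^ 0) := by positivity
    linarith
  | succ J ih =>
    intro U hU hlt
    have hsmall := ih (U.filter fun n => ‖signedSum 1 a n‖ < 2 ^ J)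
      ((Finset.filter_subset _ _).trans hU) fun n hn => (Finset.mem_filter.1 hn).2
    have hlarge := hshell (2 ^ J) (U.filter fun n => ¬ ‖signedSum 1 a n‖ < 2 ^ J)
      (one_le_pow₀ one_le_two) ((Finset.filter_subset _ _).trans hU)
      (fun n hn i => by
        have h1 := abs_add_half_le_of_signedSum_one a n i
        have h2 := hlt n (Finset.mem_filter.1 hn).1
        rw [pow_succ] at h2
        linarith)
      fun n hn => not_lt.1 (Finset.mem_filter.1 hn).2
    have hsplit : (U.card : ℝ) = (U.filter fun n => ‖signedSum 1 a n‖ < 2 ^ J).card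
        + (U.filter fun n => ¬ ‖signedSum 1 a n‖ < 2 ^ J).card := by
      exact_mod_cast (Finset.card_filter_add_card_filter_not (s := U) _).symm
    have e : ((2 : ℝ) ^ J) ^ 2 * (1 + R / 2 ^ J) = (2 ^ J) ^ 2 + R * 2 ^ J := by
      field_simp
    rw [e] at hlarge
    have h4 : C * (((2 : ℝ) ^ (J + 1)) ^ 2 + R * 2 ^ (J + 1)) =
        2 * (C * ((2 ^ J) ^ 2 + R * 2 ^ J)) + 2 * (C * (2 ^ J) ^ 2) := by
      rw [pow_succ]; ring
    have h5 : 0 ≤ C * ((2 : ℝ) ^ J) ^ 2 := by positivity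
    linarith

/-- The counting estimate in a box of radius `L` with both frequencies at most `R`, where the
signed sum is comparable to `R` as soon as `R` is much larger than `L`. -/
lemma exists_card_le_of_phase {α : ℝ} (hα₁ : 1 < α) (hα₂ : α ≤ 2) :
    ∃ C : ℝ, 0 < C ∧ ∀ (a : Fin 3 → ℤ) (ς ζ L R A : ℝ) (c : Fin 3 → ℝ) (T : Finset (Fin 3 → ℤ)),
      IsSign ς → 1 ≤ L → 1 ≤ R → 1 ≤ A → SimFreq A a →
      (∀ n ∈ T, ∀ i, |(n i : ℝ) - c i| ≤ L) → (∀ n ∈ T, ‖latticeVec n‖ ≤ R) →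
      (∀ n ∈ T, ‖latticeVec (n + a)‖ ≤ R) →
      (4 * L < R → ∀ n ∈ T, R / 4 ≤ ‖signedSum ς a n‖) →
      (∀ n ∈ T, |phase α ς a n - ζ| ≤ 1) →
      (T.card : ℝ) ≤ C * (min A L)⁻¹ * L ^ 3 := by
  obtain ⟨C, hC, hcount⟩ := exists_card_le_of_signedSum_ge hα₁ hα₂
  refine ⟨54 + 320 * C, by positivity, ?_⟩
  intro a ς ζ L R A c T hς hL hR hA ha hbox hn hna hfar hφ
  have hmin : 0 < min A L := lt_min (by linarith) (by linarith)
  set X := (min A L)⁻¹ * L ^ 3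
  have hLX : L ^ 2 ≤ X := by
    simp only [X]
    rw [le_inv_mul_iff₀ hmin]
    calc min A L * L ^ 2 ≤ L * L ^ 2 := by gcongr; exact min_le_right _ _
      _ = L ^ 3 := by ring
  have hAX : L ^ 3 / A ≤ X := by
    simp only [X]
    rw [div_eq_inv_mul]
    gcongr
    exact min_le_left _ _
  have hX : 1 ≤ X := (one_le_pow₀ hL).trans hLX
  have hCX : C ≤ C * X := le_mul_of_one_le_right hC.le hX
  have hCLX := mul_le_mul_of_nonneg_left hLX hC.le
  rw [mul_assoc]
  rcases lt_or_ge (4 * L) R with hLR | hRL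
  · have h := hcount a ς ζ L R (R / 4) c T hς hL hR (by linarith) hbox hn hna (hfar hLR) hφ
    have e : R / (R / 4) = 4 := by field_simp
    rw [e] at h
    linarith
  rcases hς with rfl | rfl
  · have hpow := card_le_of_signedSum_one_lt hC (a := a) (R := R) (by linarith) (T := T)
      fun K U hK hU hUbox hUK => hcount a 1 ζ K R K _ U (Or.inl rfl) hK hR (by linarith) hUbox
        (fun n h => hn n (hU h)) (fun n h => hna n (hU h)) hUK (fun n h => hφ n (hU h))
    obtain ⟨J, hJ₁, hJ₂⟩ := exists_nat_pow_near (by linarith : 1 ≤ 8 * L) (one_lt_two (α := ℝ))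
    have h := hpow (J + 1) T subset_rfl fun n hnT => by
      refine lt_of_le_of_lt ?_ hJ₂
      have h1 : ‖signedSum 1 a n‖ ≤ ‖latticeVec (n + a)‖ + ‖latticeVec n‖ := by
        simpa [signedSum] using norm_add_le (latticeVec (n + a)) (latticeVec n)
      have h2 := hn n hnT
      have h3 := hna n hnT
      linarith
    have hJ : (2 : ℝ) ^ (J + 1) ≤ 16 * L := by rw [pow_succ]; linarith
    have hbd : ((2 : ℝ) ^ (J + 1)) ^ 2 + R * 2 ^ (J + 1) ≤ (16 * L) ^ 2 + 4 * L * (16 * L) := by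
      gcongr
    have h' := mul_le_mul_of_nonneg_left hbd hC.le
    nlinarith
  · have hv : ∀ n, signedSum (-1) a n = latticeVec a := fun n => by
      rw [signedSum, latticeVec_add]; simp
    rcases ha with ⟨hA2, haA, -⟩ | ⟨hA2, -⟩
    · have h := hcount a (-1) ζ L R (A / 2) c T (Or.inr rfl) hL hR (by linarith) hbox hn hna
        (fun n _ => by rw [hv, norm_latticeVec]; exact haA.le) hφ
      have h1 : L ^ 2 * (1 + R / (A / 2)) ≤ L ^ 2 * (1 + 4 * L / (A / 2)) := by gcongr
      have h2 : L ^ 2 * (1 + 4 * L / (A / 2)) = L ^ 2 + 8 * (L ^ 3 / A) := by field_simp; ring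
      have h3 := mul_le_mul_of_nonneg_left (h1.trans_eq h2) hC.le
      have h4 := mul_le_mul_of_nonneg_left hAX hC.le
      nlinarith
    · have h := card_le_of_box hL hbox
      have h1 : L ^ 3 / 2 ≤ L ^ 3 / A := by gcongr
      nlinarith

lemma IsDyadic.one_le {N : ℝ} (h : IsDyadic N) : 1 ≤ N := by
  obtain ⟨j, rfl⟩ := h
  exact one_le_pow₀ one_le_two

lemma SimFreq.norm_le {N : ℝ} (hN : 1 ≤ N) {n : Fin 3 → ℤ} (h : SimFreq N n) :
    ‖latticeVec n‖ ≤ N := by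
  rw [norm_latticeVec]
  rcases h with ⟨-, -, h⟩ | ⟨-, h⟩
  · exact h
  · exact h.trans hN

lemma SimFreq.half_le_norm {N : ℝ} (hN : 2 ≤ N) {n : Fin 3 → ℤ} (h : SimFreq N n) :
    N / 2 ≤ ‖latticeVec n‖ := by
  rw [norm_latticeVec]
  rcases h with ⟨-, h, -⟩ | ⟨h, -⟩
  · exact h.le
  · linarith

lemma abs_norm_sub_norm_le_norm_signedSum {ς : ℝ} (hς : IsSign ς) (a n : Fin 3 → ℤ) :
    |‖latticeVec (n + a)‖ - ‖latticeVec n‖| ≤ ‖signedSum ς a n‖ := by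
  have hςn : ‖ς‖ = 1 := by rcases hς with rfl | rfl <;> simp
  have h := abs_norm_sub_norm_le (latticeVec (n + a)) (-(ς • latticeVec n))
  rwa [norm_neg, norm_smul, hςn, one_mul, sub_neg_eq_add] at h

/-- **Two-ball counting estimate** (Lemma 3.2): for `1 < α ≤ 2` there is `C = C(α) > 0`
such that for all dyadic `N, A, B ≥ 1`, all `a ∈ ℤ³` with `|a| ∼ A`, every sign `ς`
and every `ζ ∈ ℝ`,
`#{ n : |n| ∼ N, |n+a| ∼ B, |⟪a+n⟫ + ς⟪n⟫ − ζ| ≤ 1 } ≤ C · min(A,B,N)⁻¹ · min(B,N)³`. -/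
theorem two_ball_counting (α : ℝ) (hα₁ : 1 < α) (hα₂ : α ≤ 2) :
    ∃ C : ℝ, 0 < C ∧
      ∀ N A B : ℝ, IsDyadic N → IsDyadic A → IsDyadic B →
        ∀ a : Fin 3 → ℤ, SimFreq A a → ∀ ς : ℝ, IsSign ς → ∀ ζ : ℝ,
          ∀ S : Set (Fin 3 → ℤ),
            S = {n | SimFreq N n ∧ SimFreq B (n + a) ∧
                  |jbb α (a + n) + ς * jbb α n - ζ| ≤ 1} →
            S.Finite ∧ (S.ncard : ℝ) ≤ C * (min A (min B N))⁻¹ * min B N ^ 3 := by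
  obtain ⟨C, hC, hcount⟩ := exists_card_le_of_phase hα₁ hα₂
  refine ⟨C, hC, ?_⟩
  intro N A B hN hA hB a ha ς hς ζ S hS
  have hN1 := hN.one_le
  have hB1 := hB.one_le
  obtain ⟨c, hc⟩ : ∃ c : Fin 3 → ℝ, ∀ n ∈ S, ∀ i, |(n i : ℝ) - c i| ≤ min B N := by
    rcases le_total N B with hNB | hBN
    · refine ⟨0, fun n hn i => ?_⟩
      rw [hS] at hn
      rw [min_eq_right hNB]
      refine le_trans ?_ (hn.1.norm_le hN1)
      simpa using PiLp.norm_apply_le (latticeVec n) i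
    · refine ⟨fun i => -(a i : ℝ), fun n hn i => ?_⟩
      rw [hS] at hn
      rw [min_eq_left hBN]
      refine le_trans ?_ (hn.2.1.norm_le hB1)
      simpa using PiLp.norm_apply_le (latticeVec (n + a)) i
  have hfin : S.Finite := (finite_setOf_box c (min B N)).subset hc
  refine ⟨hfin, ?_⟩
  have hmem : ∀ n ∈ hfin.toFinset, SimFreq N n ∧ SimFreq B (n + a) ∧
      |jbb α (a + n) + ς * jbb α n - ζ| ≤ 1 := by
    intro n hn
    rw [Set.Finite.mem_toFinset, hS] at hn
    exact hn
  rw [Set.ncard_eq_toFinset_card S hfin]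
  refine hcount a ς ζ (min B N) (max B N) A c _ hς (le_min hB1 hN1) (le_max_of_le_left hB1)
    hA.one_le ha (fun n hn => hc n (hfin.mem_toFinset.1 hn))
    (fun n hn => ((hmem n hn).1.norm_le hN1).trans (le_max_right _ _))
    (fun n hn => ((hmem n hn).2.1.norm_le hB1).trans (le_max_left _ _)) ?_
    (fun n hn => (hmem n hn).2.2)
  intro hlt n hn
  obtain ⟨h1, h2, -⟩ := hmem n hn
  have h := abs_norm_sub_norm_le_norm_signedSum hς a n
  rcases le_total N B with hNB | hBN
  · rw [min_eq_right hNB, max_eq_left hNB] at hlt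
    rw [max_eq_left hNB]
    have h3 := h1.norm_le hN1
    have h4 := h2.half_le_norm (by linarith)
    have h5 := le_abs_self (‖latticeVec (n + a)‖ - ‖latticeVec n‖)
    linarith
  · rw [min_eq_left hBN, max_eq_right hBN] at hlt
    rw [max_eq_right hBN]
    have h3 := h2.norm_le hB1
    have h4 := h1.half_le_norm (by linarith)
    have h5 := neg_le_abs (‖latticeVec (n + a)‖ - ‖latticeVec n‖)
    linarith
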